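/- Every element U of SU(2) (the group of 2×2 complex unitary matrices with determinant 1) can be written as the product U = â · b̂ of two matrices â, b̂ with a, b ∈ S²; i.e., products of pairs of Hermitian unitary matrices of determinant −1 of the form â yield all of SU(2). -/

import Mathlib

noncomputable section

open Matrix

/-- Euclidean 3-space. -/
abbrev E3 : Type := EuclideanSpace ℝ (Fin 3)

/-- The first Pauli matrix `σ₁`. -/
def pauli1 : Matrix (Fin 2) (Fin 2) ℂ := !![0, 1; 1, 0]

/-- The second Pauli matrix `σ₂`. -/
def pauli2 : Matrix (Fin 2) (Fin 2) ℂ := !![0, -Complex.I; Complex.I, 0]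

/-- The third Pauli matrix `σ₃`. -/
def pauli3 : Matrix (Fin 2) (Fin 2) ℂ := !![1, 0; 0, -1]

/-- `x̂ := x₁σ₁ + x₂σ₂ + x₃σ₃` for `x ∈ ℝ³`. -/
def hatM (x : E3) : Matrix (Fin 2) (Fin 2) ℂ :=
  (x 0 : ℂ) • pauli1 + (x 1 : ℂ) • pauli2 + (x 2 : ℂ) • pauli3

theorem star_eq_adjugate_of_mem_specialUnitaryGroup {n α : Type*} [Fintype n] [DecidableEq n]
    [CommRing α] [StarRing α] {A : Matrix n n α} (hA : A ∈ Matrix.specialUnitaryGroup n α) :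
    star A = A.adjugate := by
  obtain ⟨hU, hdet⟩ := Matrix.mem_specialUnitaryGroup_iff.mp hA
  have hadj : A * A.adjugate = 1 := by rw [Matrix.mul_adjugate, hdet, one_smul]
  exact left_inv_eq_right_inv (Matrix.mem_unitaryGroup_iff'.mp hU) hadj

theorem exists_unit_orthogonal_in_plane (x y : ℝ) :
    ∃ p q : ℝ, p ^ 2 + q ^ 2 = 1 ∧ p * x + q * y = 0 := by
  by_cases h : x ^ 2 + y ^ 2 = 0
  · have hx : x = 0 := by nlinarith [sq_nonneg x, sq_nonneg y]
    have hy : y = 0 := by nlinarith [sq_nonneg x, sq_nonneg y]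
    exact ⟨1, 0, by norm_num, by simp [hx]⟩
  · have hs : √(x ^ 2 + y ^ 2) ^ 2 = x ^ 2 + y ^ 2 := Real.sq_sqrt (by positivity)
    refine ⟨y / √(x ^ 2 + y ^ 2), -x / √(x ^ 2 + y ^ 2), ?_, by ring⟩
    rw [div_pow, div_pow, hs, ← add_div, neg_sq, add_comm, div_self h]

theorem hatM_eq (a b c : ℝ) :
    hatM !₂[a, b, c] = !![(c : ℂ), a - b * Complex.I; a + b * Complex.I, -c] := by
  ext i j
  fin_cases i <;> fin_cases j <;> simp [hatM, pauli1, pauli2, pauli3, sub_eq_add_neg]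

theorem norm_vec3_eq_one {a b c : ℝ} (h : a ^ 2 + b ^ 2 + c ^ 2 = 1) :
    ‖(!₂[a, b, c] : E3)‖ = 1 := by
  simp [EuclideanSpace.norm_eq, Fin.sum_univ_three, h]

/-- Every element `U` of `SU(2)` can be written as the product `U = â·b̂` with `a, b ∈ S²`;
i.e., products of pairs of the Hermitian unitary matrices `â` of determinant `-1` yield all
of `SU(2)`. -/
theorem SU2_eq_hatM_mul_hatM (U : Matrix.specialUnitaryGroup (Fin 2) ℂ) :
    ∃ a b : E3, ‖a‖ = 1 ∧ ‖b‖ = 1 ∧ (U : Matrix (Fin 2) (Fin 2) ℂ) = hatM a * hatM b := by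
  obtain ⟨A, hA⟩ := U
  have hstar := star_eq_adjugate_of_mem_specialUnitaryGroup hA
  have hdet := (Matrix.mem_specialUnitaryGroup_iff.mp hA).2
  rw [Matrix.adjugate_fin_two] at hstar
  rw [Matrix.det_fin_two] at hdet
  have h11 : A 1 1 = star (A 0 0) := by simpa using (congrFun₂ hstar 0 0).symm
  have h10 : A 1 0 = -star (A 0 1) := by
    simpa using congrArg Neg.neg (congrFun₂ hstar 1 0).symm
  obtain ⟨w, z, hα⟩ : ∃ w z : ℝ, A 0 0 = ⟨w, z⟩ := ⟨_, _, rfl⟩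
  obtain ⟨y, x, hβ⟩ : ∃ y x : ℝ, A 0 1 = ⟨y, x⟩ := ⟨_, _, rfl⟩
  have hnorm : w ^ 2 + x ^ 2 + y ^ 2 + z ^ 2 = 1 := by
    rw [h11, h10, hα, hβ] at hdet
    have := congrArg Complex.re hdet
    simp at this
    linear_combination this
  obtain ⟨p, q, hpq, horth⟩ := exists_unit_orthogonal_in_plane x y
  refine ⟨!₂[p, q, 0], !₂[w * p - q * z, w * q + p * z, q * x - p * y],
    norm_vec3_eq_one (by linear_combination hpq), norm_vec3_eq_one ?_, ?_⟩
  · linear_combination (w ^ 2 + z ^ 2 + x ^ 2 + y ^ 2) * hpq + hnorm - (p * x + q * y) * horth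
  · change A = _
    rw [hatM_eq, hatM_eq, Matrix.eta_fin_two A, h11, h10, hα, hβ, Matrix.mul_fin_two]
    ext i j
    fin_cases i <;> fin_cases j <;> apply Complex.ext <;> simp
    · linear_combination -w * hpq
    · linear_combination -z * hpq
    · linear_combination -y * hpq + q * horth
    · linear_combination -x * hpq + p * horth
    · linear_combination y * hpq - q * horth
    · linear_combination -x * hpq + p * horth
    · linear_combination -w * hpq
    · linear_combination z * hpq
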